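/- Fix α > 1 and let ξ be a random variable with the zeta distribution P{ξ=k} = k^{-α} / (∑_{m=1}^∞ m^{-α}) for k ∈ ℕ≥1. Then: (i) for every prime p and every k ∈ ℕ≥0, P{λ_p(ξ) ≥ k} = p^{-kα}, i.e. λ_p(ξ) has a geometric distribution on ℕ≥0 with parameter p^{-α}; and (ii) the random variables (λ_p(ξ))_{p prime} are mutually independent, i.e. for any finite set of distinct primes p_1,…,p_n and any nonnegative integers k_1,…,k_n, P{λ_{p_1}(ξ) ≥ k_1, …, λ_{p_n}(ξ) ≥ k_n} = ∏_{i=1}^n p_i^{-k_i α}. -/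

import Mathlib

open MeasureTheory ProbabilityTheory
open scoped ENNReal

/-- A zeta-distributed variable `ξ` is divisible by `d` with probability `d^{-α}`. -/
theorem measure_dvd_of_zeta {Ω : Type*} [MeasurableSpace Ω] {μ : Measure Ω}
    [IsProbabilityMeasure μ] {α Z : ℝ} {ξ : Ω → ℕ} (hξ : Measurable ξ) (hpos : ∀ ω, 1 ≤ ξ ω)
    (hdist : ∀ k : ℕ, 1 ≤ k → μ {ω | ξ ω = k} = ENNReal.ofReal ((k : ℝ) ^ (-α) / Z))
    {d : ℕ} (hd : 0 < d) :
    μ {ω | d ∣ ξ ω} = ENNReal.ofReal ((d : ℝ) ^ (-α)) := by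
  have measure_multiples : ∀ e : ℕ, 0 < e →
      μ {ω | e ∣ ξ ω} = ∑' m : ℕ, μ {ω | ξ ω = e * (m + 1)} := by
    intro e he
    rw [← measure_iUnion]
    · congr 1
      ext ω
      simp only [Set.mem_ofPred_eq, Set.mem_iUnion]
      constructor
      · rintro ⟨c, hc⟩
        have hc0 : c ≠ 0 := by
          rintro rfl
          have := hpos ω
          omega
        exact ⟨c - 1, by rw [Nat.sub_add_cancel (Nat.one_le_iff_ne_zero.2 hc0), hc]⟩
      · rintro ⟨m, hm⟩
        exact ⟨m + 1, hm⟩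
    · intro i j hij
      refine Set.disjoint_left.2 fun ω hi hj => hij ?_
      simp only [Set.mem_ofPred_eq] at hi hj
      have := Nat.eq_of_mul_eq_mul_left he (hi.symm.trans hj)
      omega
    · exact fun m => hξ (measurableSet_singleton (e * (m + 1)))
  have scale : ∀ m : ℕ, μ {ω | ξ ω = d * (m + 1)} =
      ENNReal.ofReal ((d : ℝ) ^ (-α)) * μ {ω | ξ ω = 1 * (m + 1)} := by
    intro m
    rw [one_mul, hdist _ (Nat.mul_pos hd m.succ_pos), hdist _ m.succ_pos,
      ← ENNReal.ofReal_mul (by positivity), Nat.cast_mul,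
      Real.mul_rpow (by positivity) (by positivity), mul_div_assoc]
  rw [measure_multiples d hd, tsum_congr scale, ENNReal.tsum_mul_left,
    ← measure_multiples 1 one_pos]
  simp

/-- If `ξ` has the zeta distribution `P{ξ = k} = k^{-α}/∑_{m ≥ 1} m^{-α}`
(`α > 1`), then for every prime `p` the prime count `λ_p(ξ)` satisfies
`P{λ_p(ξ) ≥ k} = p^{-kα}` (a geometric distribution on `ℕ₀` with parameter `p^{-α}`), and
the prime counts `(λ_p(ξ))_{p prime}` are mutually independent: for distinct primes
`p_1, …, p_n` and nonnegative integers `k_1, …, k_n`,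
`P{λ_{p_i}(ξ) ≥ k_i, i ≤ n} = ∏_i p_i^{-k_i α}`. -/
theorem stmt3 {Ω : Type*} [MeasureSpace Ω] [IsProbabilityMeasure (ℙ : Measure Ω)]
    (α : ℝ) (hα : 1 < α)
    (ξ : Ω → ℕ) (hξmeas : Measurable ξ) (hξpos : ∀ ω, 1 ≤ ξ ω)
    (hdist : ∀ k : ℕ, 1 ≤ k →
      ℙ {ω | ξ ω = k} = ENNReal.ofReal ((k : ℝ) ^ (-α) / ∑' (m : ℕ), ((m : ℝ) + 1) ^ (-α))) :
    (∀ p : ℕ, p.Prime → ∀ k : ℕ,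
        ℙ {ω | k ≤ (ξ ω).factorization p} = ENNReal.ofReal ((p : ℝ) ^ (-((k : ℝ) * α))))
    ∧ (∀ (n : ℕ) (pv : Fin n → ℕ) (kv : Fin n → ℕ),
        (∀ i, (pv i).Prime) → Function.Injective pv →
        ℙ {ω | ∀ i, kv i ≤ (ξ ω).factorization (pv i)}
          = ∏ i, ENNReal.ofReal ((pv i : ℝ) ^ (-((kv i : ℝ) * α)))) := by
  have joint : ∀ (n : ℕ) (pv : Fin n → ℕ) (kv : Fin n → ℕ),
      (∀ i, (pv i).Prime) → Function.Injective pv →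
      ℙ {ω | ∀ i, kv i ≤ (ξ ω).factorization (pv i)}
        = ∏ i, ENNReal.ofReal ((pv i : ℝ) ^ (-((kv i : ℝ) * α))) := by
    intro n pv kv hp hinj
    have hset : {ω | ∀ i, kv i ≤ (ξ ω).factorization (pv i)} =
        {ω | (∏ i, pv i ^ kv i) ∣ ξ ω} := by
      ext ω
      have h0 : ξ ω ≠ 0 := Nat.one_le_iff_ne_zero.1 (hξpos ω)
      simp only [Set.mem_ofPred_eq, ← (hp _).pow_dvd_iff_le_factorization h0]
      constructor
      · exact fun h => Fintype.prod_dvd_of_isRelPrime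
          (fun i j hij => Nat.coprime_iff_isRelPrime.1
            (Nat.coprime_pow_primes _ _ (hp i) (hp j) (hinj.ne hij))) h
      · exact fun h i => (Finset.dvd_prod_of_mem _ (Finset.mem_univ i)).trans h
    rw [hset, measure_dvd_of_zeta hξmeas hξpos hdist
      (Finset.prod_pos fun i _ => pow_pos (hp i).pos _), Nat.cast_prod,
      ← Real.finsetProd_rpow _ _ (fun i _ => by positivity),
      ENNReal.ofReal_prod_of_nonneg (fun i _ => by positivity)]
    refine Finset.prod_congr rfl fun i _ => ?_
    rw [Nat.cast_pow, ← Real.rpow_natCast_mul (by positivity), mul_neg]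
  refine ⟨fun p hp k => ?_, joint⟩
  simpa using joint 1 (fun _ => p) (fun _ => k) (fun _ => hp)
    (Function.injective_of_subsingleton _)
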